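/- arXiv:1408.6858 — 2 statements merged into one kernel-verified Lean document; each statement's English description precedes it below -/
import Mathlib

section
/- Let p = 2^e + 2^d + 1 be a prime with e > d ≥ 1, and let g denote the multiplicative order of 2 in (ℤ/pℤ)^*. Let n = 2^c + 2^b + 2^a where c > b > a ≥ 0 and n > 7, and suppose that the residues of a, b, c modulo g form the multiset {0, d mod g, e mod g}. Then the cyclotomic polynomial Φ_{2p}(t) divides the descent set polynomial Q_n(t). -/
/-- The descent set of a permutation of `Fin n`, as a subset of `[n-1] = {1,…,n-1}`
(1-based positions): `i` is a descent if `π(i) > π(i+1)`. -/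
def descentSet (n : ℕ) (π : Equiv.Perm (Fin n)) : Finset ℕ :=
  (Finset.Ico 1 n).filter fun i => ∀ h : i < n, π ⟨i, h⟩ < π ⟨i - 1, by omega⟩

/-- The descent set statistic `β_n(S)`: the number of permutations of `{1,…,n}`
with descent set `S`. -/
def beta (n : ℕ) (S : Finset ℕ) : ℕ :=
  (Finset.univ.filter fun π : Equiv.Perm (Fin n) => descentSet n π = S).card

/-- The descent set polynomial `Q_n(t) = ∑_{S ⊆ [n-1]} t^{β_n(S)}`. -/
noncomputable def Q (n : ℕ) : Polynomial ℤ :=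
  ∑ S ∈ (Finset.Ico 1 n).powerset, Polynomial.X ^ beta n S


open Finset Equiv

lemma mem_descentSet_succ {n : ℕ} (π : Perm (Fin n)) {i : ℕ} (h : i + 1 < n) :
    i + 1 ∈ descentSet n π ↔ π ⟨i + 1, h⟩ < π ⟨i, by omega⟩ := by
  simp [descentSet, h]

lemma descentSet_subset {n : ℕ} (π : Perm (Fin n)) : descentSet n π ⊆ Ico 1 n :=
  filter_subset _ _

lemma beta_empty (n : ℕ) : beta n ∅ = 1 := by
  rw [beta, card_eq_one]
  refine ⟨1, ?_⟩
  ext π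
  simp only [mem_filter, mem_univ, true_and, mem_singleton]
  cases n with
  | zero => simp [Subsingleton.elim π 1, descentSet]
  | succ n =>
    constructor
    · intro h
      have hmono : StrictMono π := by
        rw [Fin.strictMono_iff_lt_succ]
        intro i
        have hi : (i : ℕ) + 1 ∉ descentSet (n + 1) π := by simp [h]
        rw [mem_descentSet_succ π (by omega), not_lt] at hi
        refine lt_of_le_of_ne hi fun hne => ?_
        have := congrArg Fin.val (π.injective hne)
        simp at this
      ext i
      have := Subsingleton.elim (hmono.orderIsoOfSurjective _ π.surjective) (OrderIso.refl _)
      simpa using congrArg (fun f => ((f i : Fin (n + 1)) : ℕ)) this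
    · rintro rfl
      ext i
      constructor
      · intro hi
        obtain ⟨j, rfl⟩ : ∃ j, i = j + 1 := by
          have := mem_Ico.1 (descentSet_subset _ hi)
          exact ⟨i - 1, by omega⟩
        have h := (mem_Ico.1 (descentSet_subset _ hi)).2
        rw [mem_descentSet_succ _ h] at hi
        simp at hi
      · simp

/-- Glue permutations of `Fin k` and `Fin m` into a permutation of `Fin (k + m)` whose first `k`
values form the set `A`. -/
noncomputable def shufflePerm (k m : ℕ)
    (x : {A : Finset (Fin (k + m)) // A.card = k} × Perm (Fin k) × Perm (Fin m)) :
    Perm (Fin (k + m)) :=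
  finSumFinEquiv.symm.trans ((Equiv.sumCongr x.2.1 x.2.2).trans
    (finSumEquivOfFinset x.1.2 (by rw [card_compl, x.1.2]; simp)))

lemma shufflePerm_castAdd {k m : ℕ}
    (x : {A : Finset (Fin (k + m)) // A.card = k} × Perm (Fin k) × Perm (Fin m)) (i : Fin k) :
    shufflePerm k m x (Fin.castAdd m i) = x.1.1.orderEmbOfFin x.1.2 (x.2.1 i) := by
  simp [shufflePerm]

lemma shufflePerm_natAdd {k m : ℕ}
    (x : {A : Finset (Fin (k + m)) // A.card = k} × Perm (Fin k) × Perm (Fin m)) (i : Fin m) :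
    shufflePerm k m x (Fin.natAdd k i) =
      x.1.1ᶜ.orderEmbOfFin (by rw [card_compl, x.1.2]; simp) (x.2.2 i) := by
  simp [shufflePerm]

lemma shufflePerm_injective (k m : ℕ) : Function.Injective (shufflePerm k m) := by
  have himage : ∀ x, univ.image (fun i => shufflePerm k m x (Fin.castAdd m i)) = x.1.1 := by
    intro x
    simp only [shufflePerm_castAdd]
    ext y
    simp only [mem_image, mem_univ, true_and]
    rw [← Finset.mem_coe, ← range_orderEmbOfFin x.1.1 x.1.2]
    exact (x.2.1.surjective.exists (p := fun z => x.1.1.orderEmbOfFin x.1.2 z = y)).symm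
  rintro ⟨⟨A, hA⟩, σ, τ⟩ ⟨⟨B, hB⟩, σ', τ'⟩ h
  obtain rfl : A = B := by
    have h1 := himage ⟨⟨A, hA⟩, σ, τ⟩
    have h2 := himage ⟨⟨B, hB⟩, σ', τ'⟩
    rw [h] at h1
    exact h1.symm.trans h2
  have hσ : σ = σ' := by
    ext1 i
    have := congrArg (fun f : Perm (Fin (k + m)) => f (Fin.castAdd m i)) h
    simp only [shufflePerm_castAdd] at this
    exact (RelEmbedding.injective _) this
  have hτ : τ = τ' := by
    ext1 i
    have := congrArg (fun f : Perm (Fin (k + m)) => f (Fin.natAdd k i)) h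
    simp only [shufflePerm_natAdd] at this
    exact (RelEmbedding.injective _) this
  rw [hσ, hτ]

lemma shufflePerm_bijective (k m : ℕ) : Function.Bijective (shufflePerm k m) := by
  rw [Fintype.bijective_iff_injective_and_card]
  refine ⟨shufflePerm_injective k m, ?_⟩
  simp only [Fintype.card_prod, Fintype.card_perm, Fintype.card_finset_len, Fintype.card_fin]
  rw [← mul_assoc, Nat.choose_symm_add]
  exact Nat.add_choose_mul_factorial_mul_factorial k m

lemma mem_descentSet_shufflePerm_left {k m i : ℕ} (hi : i ∈ Ico 1 k)
    (x : {A : Finset (Fin (k + m)) // A.card = k} × Perm (Fin k) × Perm (Fin m)) :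
    i ∈ descentSet (k + m) (shufflePerm k m x) ↔ i ∈ descentSet k x.2.1 := by
  obtain ⟨j, rfl⟩ : ∃ j, i = j + 1 := ⟨i - 1, by have := mem_Ico.1 hi; omega⟩
  have h := (mem_Ico.1 hi).2
  rw [mem_descentSet_succ _ h, mem_descentSet_succ _ (by omega)]
  have h1 := shufflePerm_castAdd x ⟨j + 1, h⟩
  have h2 := shufflePerm_castAdd x ⟨j, by omega⟩
  simp only [Fin.castAdd_mk] at h1 h2
  rw [h1, h2, OrderEmbedding.lt_iff_lt]

lemma mem_descentSet_shufflePerm_right {k m i : ℕ} (hi : i ∈ Ico 1 m)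
    (x : {A : Finset (Fin (k + m)) // A.card = k} × Perm (Fin k) × Perm (Fin m)) :
    k + i ∈ descentSet (k + m) (shufflePerm k m x) ↔ i ∈ descentSet m x.2.2 := by
  obtain ⟨j, rfl⟩ : ∃ j, i = j + 1 := ⟨i - 1, by have := mem_Ico.1 hi; omega⟩
  have h := (mem_Ico.1 hi).2
  rw [← add_assoc, mem_descentSet_succ _ h, mem_descentSet_succ _ (by omega)]
  have h1 := shufflePerm_natAdd x ⟨j + 1, h⟩
  have h2 := shufflePerm_natAdd x ⟨j, by omega⟩
  simp only [Fin.natAdd_mk, ← add_assoc] at h1 h2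
  rw [h1, h2, OrderEmbedding.lt_iff_lt]

/-- The part of `S` below `k`. -/
def lowerPart (k : ℕ) (S : Finset ℕ) : Finset ℕ := (Ico 1 k).filter (· ∈ S)

/-- The part of `S` strictly between `k` and `k + m`, shifted down by `k`. -/
def upperPart (k m : ℕ) (S : Finset ℕ) : Finset ℕ := (Ico 1 m).filter (k + · ∈ S)

lemma beta_add_beta_insert {k m : ℕ} {S : Finset ℕ} (hk : 1 ≤ k)
    (hS : S ⊆ Ico 1 (k + m)) (hkS : k ∉ S) :
    beta (k + m) S + beta (k + m) (insert k S) =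
      (k + m).choose k * beta k (lowerPart k S) * beta m (upperPart k m S) := by
  classical
  have hcount : beta (k + m) S + beta (k + m) (insert k S) =
      (univ.filter fun π : Perm (Fin (k + m)) => (descentSet (k + m) π).erase k = S).card := by
    rw [beta, beta, ← card_union_of_disjoint]
    · congr 1
      ext π
      simp only [mem_union, mem_filter, mem_univ, true_and]
      constructor
      · rintro (h | h)
        · rw [h, erase_eq_of_notMem hkS]
        · rw [h, erase_insert hkS]
      · rintro rfl
        by_cases hk' : k ∈ descentSet (k + m) π
        · right; rw [insert_erase hk']
        · left; rw [erase_eq_of_notMem hk']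
    · rw [disjoint_filter]
      intro π _ h h'
      rw [h] at h'
      exact hkS (h' ▸ mem_insert_self k S)
  have hiff : ∀ x : {A : Finset (Fin (k + m)) // A.card = k} × Perm (Fin k) × Perm (Fin m),
      (descentSet (k + m) (shufflePerm k m x)).erase k = S ↔
        descentSet k x.2.1 = lowerPart k S ∧ descentSet m x.2.2 = upperPart k m S := by
    intro x
    constructor
    · rintro rfl
      constructor
      · ext i
        by_cases hi : i ∈ Ico 1 k
        · have := mem_descentSet_shufflePerm_left hi x
          have hik : i ≠ k := by have := mem_Ico.1 hi; omega
          simp [lowerPart, mem_erase, this, hik]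
          intro h
          simpa using hi
        · have : i ∉ descentSet k x.2.1 := fun h => hi (descentSet_subset _ h)
          simp only [this, lowerPart, mem_filter, hi, false_and]
      · ext i
        by_cases hi : i ∈ Ico 1 m
        · have := mem_descentSet_shufflePerm_right hi x
          have hik : i ≠ 0 := by have := mem_Ico.1 hi; omega
          simp [upperPart, mem_erase, this, hik]
          intro h
          simpa using hi
        · have : i ∉ descentSet m x.2.2 := fun h => hi (descentSet_subset _ h)
          simp only [this, upperPart, mem_filter, hi, false_and]
    · rintro ⟨h1, h2⟩
      ext i
      rcases lt_trichotomy i k with hi | rfl | hi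
      · by_cases h0 : 1 ≤ i
        · have hi' : i ∈ Ico 1 k := mem_Ico.2 ⟨h0, hi⟩
          rw [mem_erase, mem_descentSet_shufflePerm_left hi' x, h1, lowerPart, mem_filter]
          simp [hi', hi.ne]
        · have h3 : i ∉ Ico 1 (k + m) := by simp [h0]
          have h4 : i ∉ S := fun h => h3 (hS h)
          have h5 : i ∉ descentSet (k + m) (shufflePerm k m x) :=
            fun h => h3 (descentSet_subset _ h)
          simp [h4, h5]
      · simp [hkS]
      · obtain ⟨j, rfl⟩ := Nat.exists_eq_add_of_lt hi
        by_cases h0 : j + 1 < m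
        · have hi' : j + 1 ∈ Ico 1 m := mem_Ico.2 ⟨by omega, h0⟩
          rw [mem_erase, add_assoc, mem_descentSet_shufflePerm_right hi' x, h2, upperPart,
            mem_filter]
          simp [h0]
        · have h3 : k + j + 1 ∉ Ico 1 (k + m) := by simp; omega
          have h4 : k + j + 1 ∉ S := fun h => h3 (hS h)
          have h5 : k + j + 1 ∉ descentSet (k + m) (shufflePerm k m x) :=
            fun h => h3 (descentSet_subset _ h)
          simp [h4, h5]
  rw [hcount]
  have hcard : (univ.filter fun x : {A : Finset (Fin (k + m)) // A.card = k} ×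
      Perm (Fin k) × Perm (Fin m) => descentSet k x.2.1 = lowerPart k S ∧
        descentSet m x.2.2 = upperPart k m S).card =
      (univ.filter fun π : Perm (Fin (k + m)) => (descentSet (k + m) π).erase k = S).card := by
    refine card_bijective _ (shufflePerm_bijective k m) fun x => ?_
    simp [hiff x]
  rw [← hcard, ← univ_product_univ]
  have hprod := filter_product (s := (univ : Finset {A : Finset (Fin (k + m)) // A.card = k}))
    (t := (univ : Finset (Perm (Fin k) × Perm (Fin m)))) (fun _ => True)
    (fun y => descentSet k y.1 = lowerPart k S ∧ descentSet m y.2 = upperPart k m S)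
  have hprod' := filter_product (s := (univ : Finset (Perm (Fin k))))
    (t := (univ : Finset (Perm (Fin m)))) (fun σ => descentSet k σ = lowerPart k S)
    (fun τ => descentSet m τ = upperPart k m S)
  simp only [true_and] at hprod
  rw [hprod, card_product, ← univ_product_univ, hprod', card_product]
  simp [beta, mul_assoc]

lemma beta_add_beta_symmDiff {n k : ℕ} {S : Finset ℕ} (hk : k ∈ Ico 1 n) (hS : S ⊆ Ico 1 n) :
    beta n S + beta n (symmDiff S {k}) =
      n.choose k * beta k (lowerPart k S) * beta (n - k) (upperPart k (n - k) S) := by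
  obtain ⟨hk1, hkn⟩ := mem_Ico.1 hk
  obtain ⟨m, rfl⟩ := Nat.exists_eq_add_of_le hkn.le
  rw [Nat.add_sub_cancel_left]
  by_cases hkS : k ∈ S
  · have h1 : symmDiff S {k} = S.erase k := by
      ext i; simp only [mem_symmDiff, mem_singleton, mem_erase]; grind
    have h2 : lowerPart k (S.erase k) = lowerPart k S := by
      ext i; simp only [lowerPart, mem_filter, mem_Ico, mem_erase]; grind
    have h3 : upperPart k m (S.erase k) = upperPart k m S := by
      ext i; simp only [upperPart, mem_filter, mem_Ico, mem_erase]; grind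
    have h := beta_add_beta_insert hk1 ((erase_subset k S).trans hS) (notMem_erase k S)
    rwa [insert_erase hkS, h2, h3, add_comm, ← h1] at h
  · have h1 : symmDiff S {k} = insert k S := by
      ext i; simp only [mem_symmDiff, mem_singleton, mem_insert]; grind
    rw [h1]
    exact beta_add_beta_insert hk1 hS hkS

lemma symmDiff_singleton_subset {n k : ℕ} {S : Finset ℕ} (hk : k ∈ Ico 1 n) (hS : S ⊆ Ico 1 n) :
    symmDiff S {k} ⊆ Ico 1 n := by
  intro i hi
  rw [mem_symmDiff, mem_singleton] at hi
  rcases hi with ⟨hi, -⟩ | ⟨rfl, -⟩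
  · exact hS hi
  · exact hk

lemma lowerPart_subset (k : ℕ) (S : Finset ℕ) : lowerPart k S ⊆ Ico 1 k := filter_subset _ _

lemma upperPart_subset (k m : ℕ) (S : Finset ℕ) : upperPart k m S ⊆ Ico 1 m := filter_subset _ _

open Polynomial in
lemma choose_two_pow_add_two_pow_zmod (a b k : ℕ) :
    ((2 ^ a + 2 ^ b).choose k : ZMod 2) =
      ((1 + X ^ 2 ^ a + X ^ 2 ^ b + X ^ (2 ^ a + 2 ^ b) : (ZMod 2)[X])).coeff k := by
  rw [← coeff_one_add_X_pow, pow_add, add_pow_char_pow (p := 2), add_pow_char_pow (p := 2)]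
  congr 1
  ring

open Polynomial in
lemma choose_three_two_pow_zmod (a b c k : ℕ) :
    ((2 ^ c + 2 ^ b + 2 ^ a).choose k : ZMod 2) =
      ((1 + X ^ 2 ^ a + X ^ 2 ^ b + X ^ 2 ^ c + X ^ (2 ^ a + 2 ^ b) + X ^ (2 ^ a + 2 ^ c) +
        X ^ (2 ^ b + 2 ^ c) + X ^ (2 ^ c + 2 ^ b + 2 ^ a) : (ZMod 2)[X])).coeff k := by
  rw [← coeff_one_add_X_pow, pow_add, pow_add, add_pow_char_pow (p := 2),
    add_pow_char_pow (p := 2), add_pow_char_pow (p := 2)]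
  congr 1
  ring

lemma odd_choose_two_pow_add_two_pow_iff {a b k : ℕ} (hab : a < b)
    (hk : k ∈ Ico 1 (2 ^ a + 2 ^ b)) :
    Odd ((2 ^ a + 2 ^ b).choose k) ↔ k = 2 ^ a ∨ k = 2 ^ b := by
  have hk := mem_Ico.1 hk
  have h : 2 ^ a < 2 ^ b := Nat.pow_lt_pow_right one_lt_two hab
  rw [← ZMod.natCast_eq_one_iff_odd, choose_two_pow_add_two_pow_zmod]
  simp only [Polynomial.coeff_add, Polynomial.coeff_X_pow, Polynomial.coeff_one]
  split_ifs <;> first | omega | simp; try omega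

lemma two_pow_add_two_pow_lt {a b c : ℕ} (hab : a < b) (hbc : b < c) :
    2 ^ a + 2 ^ b < 2 ^ c := by
  have h1 : 2 ^ a < 2 ^ b := Nat.pow_lt_pow_right one_lt_two hab
  have h2 : 2 ^ (b + 1) ≤ 2 ^ c := Nat.pow_le_pow_right two_pos hbc
  rw [pow_succ] at h2
  omega

lemma odd_choose_three_two_pow_iff {a b c k : ℕ} (hab : a < b) (hbc : b < c)
    (hk : k ∈ Ico 1 (2 ^ c + 2 ^ b + 2 ^ a)) :
    Odd ((2 ^ c + 2 ^ b + 2 ^ a).choose k) ↔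
      k ∈ ({2 ^ a, 2 ^ b, 2 ^ c, 2 ^ a + 2 ^ b, 2 ^ a + 2 ^ c, 2 ^ b + 2 ^ c} : Finset ℕ) := by
  have hk := mem_Ico.1 hk
  have h1 : 2 ^ a < 2 ^ b := Nat.pow_lt_pow_right one_lt_two hab
  have h2 := two_pow_add_two_pow_lt hab hbc
  have h3 : 0 < 2 ^ a := by positivity
  rw [← ZMod.natCast_eq_one_iff_odd, choose_three_two_pow_zmod]
  simp only [Polynomial.coeff_add, Polynomial.coeff_X_pow, Polynomial.coeff_one, mem_insert,
    mem_singleton]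
  generalize 2 ^ a = u at *
  generalize 2 ^ b = v at *
  generalize 2 ^ c = w at *
  by_cases h : k = u ∨ k = v ∨ k = w ∨ k = u + v ∨ k = u + w ∨ k = v + w
  · simp only [h, iff_true]
    rcases h with h | h | h | h | h | h <;> subst h <;>
    · repeat rw [if_neg (by omega)]
      split_ifs <;> first | omega | simp
  · simp only [h, iff_false]
    push Not at h
    simp [h, show k ≠ 0 by omega, show k ≠ w + v + u by omega]

lemma odd_beta_two_pow (a : ℕ) {S : Finset ℕ} (hS : S ⊆ Ico 1 (2 ^ a)) :
    Odd (beta (2 ^ a) S) := by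
  induction S using Finset.induction_on with
  | empty => simp [beta_empty]
  | insert k S hkS ih =>
    obtain ⟨hk, hS⟩ := insert_subset_iff.1 hS
    have hk' := mem_Ico.1 hk
    have h1 : symmDiff S {k} = insert k S := by
      ext i; simp only [mem_symmDiff, mem_singleton, mem_insert]; grind
    have h := beta_add_beta_symmDiff hk hS
    have h2 : Even (beta (2 ^ a) S + beta (2 ^ a) (insert k S)) := by
      rw [← h1, h, mul_assoc]
      exact (even_iff_two_dvd.2
        (Nat.prime_two.dvd_choose_pow (by omega) (by omega))).mul_right _
    exact (Nat.even_add'.1 h2).1 (ih hS)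

lemma odd_beta_two_pow_add_two_pow_iff {a b : ℕ} (hab : a < b) {S : Finset ℕ}
    (hS : S ⊆ Ico 1 (2 ^ a + 2 ^ b)) :
    Odd (beta (2 ^ a + 2 ^ b) S) ↔ (2 ^ a ∈ S ↔ 2 ^ b ∈ S) := by
  induction S using Finset.induction_on with
  | empty => simp [beta_empty]
  | insert k S hkS ih =>
    obtain ⟨hk, hS⟩ := insert_subset_iff.1 hS
    have hne : 2 ^ a ≠ 2 ^ b := (Nat.pow_lt_pow_right one_lt_two hab).ne
    have h1 : symmDiff S {k} = insert k S := by
      ext i; simp only [mem_symmDiff, mem_singleton, mem_insert]; grind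
    have h := beta_add_beta_symmDiff hk hS
    rw [h1] at h
    have hodd := odd_choose_two_pow_add_two_pow_iff hab hk
    have key : Odd (beta (2 ^ a + 2 ^ b) S + beta (2 ^ a + 2 ^ b) (insert k S)) ↔
        k = 2 ^ a ∨ k = 2 ^ b := by
      rw [h, Nat.odd_mul, Nat.odd_mul, hodd]
      constructor
      · exact fun h => h.1.1
      · rintro (rfl | rfl)
        · refine ⟨⟨Or.inl rfl, odd_beta_two_pow a (lowerPart_subset _ _)⟩, ?_⟩
          rw [Nat.add_sub_cancel_left]
          exact odd_beta_two_pow b (upperPart_subset _ _ _)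
        · refine ⟨⟨Or.inr rfl, odd_beta_two_pow b (lowerPart_subset _ _)⟩, ?_⟩
          rw [Nat.add_sub_cancel]
          exact odd_beta_two_pow a (upperPart_subset _ _ _)
    have ih := ih hS
    rw [Nat.odd_add, ← Nat.not_odd_iff_even, ih] at key
    simp only [mem_insert]
    by_cases hka : k = 2 ^ a
    · subst hka; grind
    · by_cases hkb : k = 2 ^ b
      · subst hkb; grind
      · grind

/-- Toggling the singleton vertex `2 ^ a` of the hexagon changes the parity of `β` when its two
neighbours agree. -/
lemma odd_beta_add_beta_symmDiff_two_pow {n a b c : ℕ} (hbc : b < c) {S : Finset ℕ}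
    (hn : n = 2 ^ a + (2 ^ b + 2 ^ c)) (hodd : Odd (n.choose (2 ^ a)))
    (hS : S ⊆ Ico 1 n) (hiff : 2 ^ a + 2 ^ b ∈ S ↔ 2 ^ a + 2 ^ c ∈ S) :
    Odd (beta n S + beta n (symmDiff S {2 ^ a})) := by
  have h1 : 0 < 2 ^ a := by positivity
  have h2 : 0 < 2 ^ b := by positivity
  have h3 : 0 < 2 ^ c := by positivity
  rw [beta_add_beta_symmDiff (mem_Ico.2 ⟨h1, by omega⟩) hS]
  refine (hodd.mul (odd_beta_two_pow a (lowerPart_subset _ _))).mul ?_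
  have h4 : n - 2 ^ a = 2 ^ b + 2 ^ c := by omega
  rw [h4, odd_beta_two_pow_add_two_pow_iff hbc (upperPart_subset _ _ _)]
  simp only [upperPart, mem_filter, mem_Ico, hiff]
  grind

lemma dvd_choose_of_dvd_of_not_dvd {p n k : ℕ} (hp : p.Prime) (hpn : p ∣ n) (hpk : ¬ p ∣ k)
    (hk : k ∈ Ico 1 n) : p ∣ n.choose k := by
  obtain ⟨hk1, hkn⟩ := mem_Ico.1 hk
  obtain ⟨k, rfl⟩ := Nat.exists_eq_add_of_le' hk1
  obtain ⟨n, rfl⟩ := Nat.exists_eq_add_of_le' (hk1.trans hkn.le)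
  have h := Nat.add_one_mul_choose_eq n k
  have h2 : p ∣ (n + 1).choose (k + 1) * (k + 1) := h ▸ hpn.mul_right _
  exact (hp.dvd_mul.1 h2).resolve_right hpk

lemma dvd_beta_add_beta_symmDiff {p n k : ℕ} {S : Finset ℕ} (hp : p.Prime) (hpn : p ∣ n)
    (hpk : ¬ p ∣ k) (hk : k ∈ Ico 1 n) (hS : S ⊆ Ico 1 n) :
    p ∣ beta n S + beta n (symmDiff S {k}) := by
  rw [beta_add_beta_symmDiff hk hS, mul_assoc]
  exact (dvd_choose_of_dvd_of_not_dvd hp hpn hpk hk).mul_right _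

open Polynomial in
/-- Two involutions on subsets, one negating `β` modulo `2p` and one negating `β` modulo `p`
while changing its parity, force `Φ_{2p}` to divide `Q_n`. -/
lemma cyclotomic_two_mul_dvd_Q_of_involutions {p n : ℕ} (hp0 : 0 < p)
    (σ τ : Finset ℕ → Finset ℕ) (hσ : Function.Involutive σ) (hτ : Function.Involutive τ)
    (hσS : ∀ S ⊆ Ico 1 n, σ S ⊆ Ico 1 n) (hτS : ∀ S ⊆ Ico 1 n, τ S ⊆ Ico 1 n)
    (hσp : ∀ S ⊆ Ico 1 n, 2 * p ∣ beta n S + beta n (σ S))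
    (hτp : ∀ S ⊆ Ico 1 n, p ∣ beta n S + beta n (τ S))
    (hτ2 : ∀ S ⊆ Ico 1 n, Odd (beta n S + beta n (τ S))) :
    cyclotomic (2 * p) ℤ ∣ Q n := by
  have hpos : 2 * p ≠ 0 := by omega
  set z : ℂ := Complex.exp (2 * Real.pi * Complex.I / (2 * p : ℕ))
  have hz : IsPrimitiveRoot z (2 * p) := Complex.isPrimitiveRoot_exp _ hpos
  rw [cyclotomic_eq_minpoly hz (by omega)]
  refine minpoly.isIntegrallyClosed_dvd (hz.isIntegral (by omega)) ?_
  have hz0 : z ≠ 0 := hz.ne_zero hpos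
  have hzp : z ^ p = -1 := by
    have h := hz.pow (by omega : 0 < 2 * p) (mul_comm 2 p)
    exact h.eq_neg_one_of_two_right
  have hsum : aeval z (Q n) = ∑ S ∈ (Ico 1 n).powerset, z ^ beta n S := by
    simp [Q]
  have hσsum : ∑ S ∈ (Ico 1 n).powerset, z ^ beta n S =
      ∑ S ∈ (Ico 1 n).powerset, (z ^ beta n S)⁻¹ := by
    refine sum_nbij' σ σ ?_ ?_ (fun S _ => hσ S) (fun S _ => hσ S) ?_
    · exact fun S hS => mem_powerset.2 (hσS S (mem_powerset.1 hS))
    · exact fun S hS => mem_powerset.2 (hσS S (mem_powerset.1 hS))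
    · intro S hS
      refine eq_inv_of_mul_eq_one_left ?_
      rw [← pow_add]
      exact (hz.pow_eq_one_iff_dvd _).2 (hσp S (mem_powerset.1 hS))
  have hτsum : ∑ S ∈ (Ico 1 n).powerset, z ^ beta n S =
      ∑ S ∈ (Ico 1 n).powerset, -(z ^ beta n S)⁻¹ := by
    refine sum_nbij' τ τ ?_ ?_ (fun S _ => hτ S) (fun S _ => hτ S) ?_
    · exact fun S hS => mem_powerset.2 (hτS S (mem_powerset.1 hS))
    · exact fun S hS => mem_powerset.2 (hτS S (mem_powerset.1 hS))
    · intro S hS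
      have hS := mem_powerset.1 hS
      obtain ⟨q, hq⟩ := hτp S hS
      have hodd : Odd q := by
        have := hτ2 S hS
        rw [hq, Nat.odd_mul] at this
        exact this.2
      have h : z ^ beta n S * z ^ beta n (τ S) = -1 := by
        rw [← pow_add, hq, pow_mul, hzp, hodd.neg_one_pow]
      rw [← neg_eq_iff_eq_neg]
      refine eq_inv_of_mul_eq_one_left ?_
      rw [neg_mul, h, neg_neg]
  rw [sum_neg_distrib, ← hσsum] at hτsum
  rw [hsum]
  exact self_eq_neg.1 hτsum

/-- Toggle one of `u`, `v`, `w`, chosen so that its two neighbours in the hexagon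
`u, u + v, v, v + w, w, u + w` agree on `S`. -/
def hexagonToggle (u v w : ℕ) (S : Finset ℕ) : Finset ℕ :=
  if u + v ∈ S ↔ u + w ∈ S then symmDiff S {u}
  else if v + u ∈ S ↔ v + w ∈ S then symmDiff S {v}
  else symmDiff S {w}

lemma hexagonToggle_involutive {u v w : ℕ} (hu : 0 < u) (huv : u < v) (huvw : u + v < w) :
    Function.Involutive (hexagonToggle u v w) := by
  have hmem : ∀ S : Finset ℕ, ∀ x ∈ ({u, v, w} : Finset ℕ), ∀ y ∈ ({u + v, u + w, v + u, v + w} : Finset ℕ),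
      y ∈ symmDiff S {x} ↔ y ∈ S := by
    intro S x hx y hy
    simp only [mem_insert, mem_singleton] at hx hy
    have hne : y ≠ x := by omega
    simp [mem_symmDiff, hne]
  simp only [mem_insert, mem_singleton, forall_eq_or_imp, forall_eq] at hmem
  intro S
  have h := hmem S
  unfold hexagonToggle
  split_ifs <;> first | exact symmDiff_symmDiff_cancel_right _ _ | grind

lemma hexagonToggle_induction {u v w : ℕ} {S : Finset ℕ} {P : Finset ℕ → Prop}
    (hu : (u + v ∈ S ↔ u + w ∈ S) → P (symmDiff S {u}))
    (hv : (v + u ∈ S ↔ v + w ∈ S) → P (symmDiff S {v}))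
    (hw : (w + u ∈ S ↔ w + v ∈ S) → P (symmDiff S {w})) : P (hexagonToggle u v w S) := by
  unfold hexagonToggle
  split_ifs with h1 h2
  · exact hu h1
  · exact hv h2
  · refine hw ?_
    rw [add_comm w u, add_comm w v]
    rw [add_comm v u] at h2
    tauto

lemma exists_not_dvd_notMem {p n : ℕ} (hp : 7 ≤ p) (hpn : p ∣ n) (hn : 7 < n) {s : Finset ℕ}
    (hs : s.card ≤ 6) : ∃ k ∈ Ico 1 n, ¬ p ∣ k ∧ k ∉ s := by
  by_contra! hcon
  have hpn' := Nat.le_of_dvd (by omega) hpn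
  have hsub : ({1, 2, 3, 4, 5, 6, if p = 7 then 8 else 7} : Finset ℕ) ⊆ s := by
    intro k hk
    have hk' : (1 ≤ k ∧ k ≤ 6) ∨ (p = 7 ∧ k = 8) ∨ (p ≠ 7 ∧ k = 7) := by
      simp only [mem_insert, mem_singleton] at hk
      split_ifs at hk <;> omega
    refine hcon k (mem_Ico.2 ⟨by omega, ?_⟩) ?_
    · rcases hk' with h | ⟨rfl, rfl⟩ | h <;> omega
    · rcases hk' with h | ⟨rfl, rfl⟩ | h
      · exact Nat.not_dvd_of_pos_of_lt (by omega) (by omega)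
      · decide
      · exact Nat.not_dvd_of_pos_of_lt (by omega) (by omega)
  have := card_le_card hsub
  split_ifs at this <;> simp at this <;> omega

/-- Let `p = 2^e + 2^d + 1` be prime with `e > d ≥ 1`, and `g` the
multiplicative order of `2` modulo `p`. Let `n = 2^c + 2^b + 2^a` with
`c > b > a ≥ 0` and `n > 7`. If the residues of `a, b, c` modulo `g` form the
multiset `{0, d mod g, e mod g}`, then `Φ_{2p}` divides `Q_n(t)`. -/
theorem cyclotomic_two_p_dvd_three_digits_three (p a b c d e g : ℕ)
    (hde : d < e) (hd : 1 ≤ d) (hpval : p = 2 ^ e + 2 ^ d + 1) (hp : p.Prime)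
    (hg : g = orderOf (2 : ZMod p))
    (hab : a < b) (hbc : b < c) (hn : 7 < 2 ^ c + 2 ^ b + 2 ^ a)
    (hcong : ({a % g, b % g, c % g} : Multiset ℕ) = {0, d % g, e % g}) :
    Polynomial.cyclotomic (2 * p) ℤ ∣ Q (2 ^ c + 2 ^ b + 2 ^ a) := by
  set n := 2 ^ c + 2 ^ b + 2 ^ a with hndef
  have hd2 : 2 ^ 1 ≤ 2 ^ d := Nat.pow_le_pow_right two_pos hd
  have he4 : 2 ^ 2 ≤ 2 ^ e := Nat.pow_le_pow_right two_pos (by omega)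
  have hp7 : 7 ≤ p := by omega
  have hpcast : ((2 ^ e + 2 ^ d + 1 : ℕ) : ZMod p) = 0 := by
    rw [← hpval]; exact ZMod.natCast_self p
  push_cast at hpcast
  -- the residues of the binary digits of `n` are those of the binary digits of `p`
  have hdigits : ({(2 : ZMod p) ^ a, 2 ^ b, 2 ^ c} : Multiset (ZMod p)) = {1, 2 ^ d, 2 ^ e} := by
    have h := congrArg (Multiset.map fun i => (2 : ZMod p) ^ i) hcong
    simpa [hg, pow_mod_orderOf] using h
  have hpn : p ∣ n := by
    rw [← ZMod.natCast_eq_zero_iff]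
    have h := congrArg Multiset.sum hdigits
    simp only [Multiset.insert_eq_cons, Multiset.sum_cons, Multiset.sum_singleton] at h
    rw [hndef]
    push_cast
    linear_combination h + hpcast
  have hcop : ∀ i, ¬ p ∣ 2 ^ i := fun i h => by
    have := Nat.le_of_dvd two_pos (hp.dvd_of_dvd_pow h)
    omega
  have hua := two_pow_add_two_pow_lt hab hbc
  have hu0 : 0 < 2 ^ a := by positivity
  have huv : 2 ^ a < 2 ^ b := Nat.pow_lt_pow_right one_lt_two hab
  obtain ⟨k, hk, hpk, hks⟩ := exists_not_dvd_notMem hp7 hpn hn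
    (s := {2 ^ a, 2 ^ b, 2 ^ c, 2 ^ a + 2 ^ b, 2 ^ a + 2 ^ c, 2 ^ b + 2 ^ c}) card_le_six
  have ha : 2 ^ a ∈ Ico 1 n := mem_Ico.2 (by omega)
  have hb : 2 ^ b ∈ Ico 1 n := mem_Ico.2 (by omega)
  have hc : 2 ^ c ∈ Ico 1 n := mem_Ico.2 (by omega)
  have hchoose := @odd_choose_three_two_pow_iff a b c
  refine cyclotomic_two_mul_dvd_Q_of_involutions hp.pos (fun S => symmDiff S {k})
    (hexagonToggle (2 ^ a) (2 ^ b) (2 ^ c)) (fun S => symmDiff_symmDiff_cancel_right _ _)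
    (hexagonToggle_involutive hu0 huv hua) (fun S hS => symmDiff_singleton_subset hk hS) ?_ ?_ ?_ ?_
  · intro S hS
    exact hexagonToggle_induction (P := (· ⊆ Ico 1 n))
      (fun _ => symmDiff_singleton_subset ha hS)
      (fun _ => symmDiff_singleton_subset hb hS) (fun _ => symmDiff_singleton_subset hc hS)
  · intro S hS
    refine Nat.Coprime.mul_dvd_of_dvd_of_dvd ?_ ?_ (dvd_beta_add_beta_symmDiff hp hpn hpk hk hS)
    · exact (Nat.coprime_primes Nat.prime_two hp).2 (by omega)
    · rw [beta_add_beta_symmDiff hk hS, mul_assoc]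
      refine Dvd.dvd.mul_right ?_ _
      rw [← even_iff_two_dvd, ← Nat.not_odd_iff_even, hchoose hab hbc hk]
      exact hks
  · intro S hS
    exact hexagonToggle_induction (P := fun T => p ∣ beta n S + beta n T)
      (fun _ => dvd_beta_add_beta_symmDiff hp hpn (hcop a) ha hS)
      (fun _ => dvd_beta_add_beta_symmDiff hp hpn (hcop b) hb hS)
      (fun _ => dvd_beta_add_beta_symmDiff hp hpn (hcop c) hc hS)
  · intro S hS
    refine hexagonToggle_induction (P := fun T => Odd (beta n S + beta n T))
      (odd_beta_add_beta_symmDiff_two_pow hbc (by omega) ((hchoose hab hbc ha).2 (by simp)) hS)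
      (odd_beta_add_beta_symmDiff_two_pow (hab.trans hbc) (by omega)
        ((hchoose hab hbc hb).2 (by simp)) hS)
      (odd_beta_add_beta_symmDiff_two_pow hab (by omega)
        ((hchoose hab hbc hc).2 (by simp)) hS)
end

section
/- Let n ≥ 1 and let w be a word in the two letters c and d, where c has degree 1 and d has degree 2, of total degree 2n−1 and containing exactly j letters d. Let E(w) be the set of words u over the alphabet {a, b} of length 2n−1 obtained from w by replacing each letter c by either a or b and each letter d by either ab or ba; for such a word u = u_1 u_2 ⋯ u_{2n−1}, let S_u = {i ∈ [2n−1] : u_i = b}. Then ∑_{u ∈ E(w)} (−1)^{β_{2n}(S_u)} = 2^{2n−j−1} · (1 − 2·ρ(n)). -/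
/-- The proportion of odd descent set statistics:
`ρ(n) = #{S ⊆ [n-1] : β_n(S) odd} / 2^{n-1}`. -/
def rho (n : ℕ) : ℚ :=
  ((Finset.Ico 1 n).powerset.filter fun S => Odd (beta n S)).card / 2 ^ (n - 1)

/-- The set of `ab`-words (`false` = `a`, `true` = `b`) in the expansion of a
`cd`-word (`false` = `c`, `true` = `d`): each `c` is replaced by `a` or `b`,
and each `d` by `ab` or `ba`. -/
def expansions : List Bool → List (List Bool)
  | [] => [[]]
  | false :: w => (expansions w).flatMap fun u => [false :: u, true :: u]
  | true :: w => (expansions w).flatMap fun u => [false :: true :: u, true :: false :: u]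

section BetaParity

variable {n : ℕ}

/-- The value `2k` in `Fin (2n)`. -/
def pairLo (k : Fin n) : Fin (2 * n) := ⟨2 * k, by omega⟩

/-- The value `2k + 1` in `Fin (2n)`. -/
def pairHi (k : Fin n) : Fin (2 * n) := ⟨2 * k + 1, by omega⟩

/-- The values `2k` and `2k + 1` occupy neighbouring positions of `π`. -/
def PairAdjacent (π : Equiv.Perm (Fin (2 * n))) (k : Fin n) : Prop :=
  (π.symm (pairLo k) : ℕ) + 1 = π.symm (pairHi k) ∨ (π.symm (pairHi k) : ℕ) + 1 = π.symm (pairLo k)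

instance (π : Equiv.Perm (Fin (2 * n))) (k : Fin n) : Decidable (PairAdjacent π k) := by
  unfold PairAdjacent
  infer_instance

/-- The pairs of values `2k`, `2k + 1` that do not occupy neighbouring positions of `π`. -/
def separatedPairs (π : Equiv.Perm (Fin (2 * n))) : Finset (Fin n) :=
  Finset.univ.filter fun k => ¬ PairAdjacent π k

theorem mem_descentSet {m : ℕ} {π : Equiv.Perm (Fin m)} {i : ℕ} :
    i ∈ descentSet m π ↔
      ∃ (h1 : 1 ≤ i) (h : i < m), π ⟨i, h⟩ < π ⟨i - 1, by omega⟩ := by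
  simp only [descentSet, Finset.mem_filter, Finset.mem_Ico]
  constructor
  · rintro ⟨⟨h1, h2⟩, h⟩
    exact ⟨h1, h2, h h2⟩
  · rintro ⟨h1, h2, h⟩
    exact ⟨⟨h1, h2⟩, fun _ => h⟩

theorem pairAdjacent_swap_mul (π : Equiv.Perm (Fin (2 * n))) (k l : Fin n) :
    PairAdjacent (Equiv.swap (pairLo k) (pairHi k) * π) l ↔ PairAdjacent π l := by
  have key : ∀ x, (Equiv.swap (pairLo k) (pairHi k) * π).symm x =
      π.symm (Equiv.swap (pairLo k) (pairHi k) x) := by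
    intro x
    rw [Equiv.symm_apply_eq]
    simp
  unfold PairAdjacent
  rw [key, key]
  by_cases hkl : l = k
  · subst hkl
    rw [Equiv.swap_apply_left, Equiv.swap_apply_right]
    exact or_comm
  · have hne : (l : ℕ) ≠ k := fun h => hkl (Fin.ext h)
    rw [Equiv.swap_apply_of_ne_of_ne, Equiv.swap_apply_of_ne_of_ne] <;>
      · simp only [pairLo, pairHi, ne_eq, Fin.mk.injEq]
        omega

theorem separatedPairs_swap_mul (π : Equiv.Perm (Fin (2 * n))) (k : Fin n) :
    separatedPairs (Equiv.swap (pairLo k) (pairHi k) * π) = separatedPairs π := by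
  ext l
  simp [separatedPairs, pairAdjacent_swap_mul]

theorem swap_pair_lt_swap_pair_iff (k : Fin n) {x y : Fin (2 * n)}
    (h1 : ¬ (x = pairLo k ∧ y = pairHi k)) (h2 : ¬ (x = pairHi k ∧ y = pairLo k)) :
    Equiv.swap (pairLo k) (pairHi k) x < Equiv.swap (pairLo k) (pairHi k) y ↔ x < y := by
  simp only [Equiv.swap_apply_def]
  simp only [pairLo, pairHi, Fin.ext_iff] at *
  split_ifs <;> simp only [Fin.lt_def] <;> omega

theorem descentSet_swap_mul {π : Equiv.Perm (Fin (2 * n))} {k : Fin n}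
    (hk : ¬ PairAdjacent π k) :
    descentSet (2 * n) (Equiv.swap (pairLo k) (pairHi k) * π) = descentSet (2 * n) π := by
  ext i
  simp only [mem_descentSet, Equiv.Perm.mul_apply]
  refine exists_congr fun h1 => exists_congr fun h => swap_pair_lt_swap_pair_iff k ?_ ?_
  · rintro ⟨hx, hy⟩
    refine hk (Or.inr ?_)
    rw [← hx, ← hy]
    simp only [Equiv.symm_apply_apply]
    omega
  · rintro ⟨hx, hy⟩
    refine hk (Or.inl ?_)
    rw [← hx, ← hy]
    simp only [Equiv.symm_apply_apply]
    omega

/-- The permutations with a given descent set that separate some pair `2k`, `2k + 1` are even in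
number: exchanging the two values of the first such pair is a fixed-point-free involution. -/
theorem even_card_separated (S : Finset ℕ) :
    Even (Finset.univ.filter fun π : Equiv.Perm (Fin (2 * n)) =>
      descentSet (2 * n) π = S ∧ (separatedPairs π).Nonempty).card := by
  rw [← ZMod.natCast_eq_zero_iff_even, Finset.card_eq_sum_ones, Nat.cast_sum]
  have hmem : ∀ π ∈ (Finset.univ.filter fun π : Equiv.Perm (Fin (2 * n)) =>
      descentSet (2 * n) π = S ∧ (separatedPairs π).Nonempty), (separatedPairs π).Nonempty :=
    fun π hπ => (Finset.mem_filter.1 hπ).2.2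
  refine Finset.sum_involution
    (fun π hπ => Equiv.swap (pairLo ((separatedPairs π).min' (hmem π hπ)))
      (pairHi ((separatedPairs π).min' (hmem π hπ))) * π) ?_ ?_ ?_ ?_
  · intro π _
    decide
  · intro π hπ _ h
    have h' := mul_eq_right.1 h
    rw [Equiv.swap_eq_one_iff] at h'
    simp [pairLo, pairHi] at h'
  · intro π hπ
    have hS := (Finset.mem_filter.1 hπ).2.1
    refine Finset.mem_filter.2 ⟨Finset.mem_univ _, ?_, ?_⟩
    · rw [descentSet_swap_mul, hS]
      exact (Finset.mem_filter.1 ((separatedPairs π).min'_mem (hmem π hπ))).2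
    · rw [separatedPairs_swap_mul]
      exact hmem π hπ
  · intro π hπ
    simp only [separatedPairs_swap_mul, Equiv.swap_mul_self_mul]

theorem PairAdjacent.exists_neighbour {π : Equiv.Perm (Fin (2 * n))}
    (hπ : ∀ k, PairAdjacent π k) (p : Fin (2 * n)) :
    ∃ q : Fin (2 * n), ((q : ℕ) = p + 1 ∨ (p : ℕ) = q + 1) ∧ (π p : ℕ) / 2 = (π q : ℕ) / 2 := by
  have hlt := (π p).isLt
  set k : Fin n := ⟨(π p : ℕ) / 2, by omega⟩ with hk
  have hcase : π p = pairLo k ∨ π p = pairHi k := by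
    simp only [pairLo, pairHi, Fin.ext_iff, hk]
    omega
  have hadj := hπ k
  unfold PairAdjacent at hadj
  rcases hcase with h | h
  · refine ⟨π.symm (pairHi k), ?_, ?_⟩
    · rw [← h, Equiv.symm_apply_apply] at hadj
      omega
    · simp only [Equiv.apply_symm_apply, h, pairLo, pairHi]
      omega
  · refine ⟨π.symm (pairLo k), ?_, ?_⟩
    · rw [← h, Equiv.symm_apply_apply] at hadj
      omega
    · simp only [Equiv.apply_symm_apply, h, pairLo, pairHi]
      omega

/-- If no pair of values `2k`, `2k + 1` is separated, these pairs fill the blocks of positions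
`2i`, `2i + 1`. -/
theorem PairAdjacent.apply_div_two_eq {π : Equiv.Perm (Fin (2 * n))}
    (hπ : ∀ k, PairAdjacent π k) (i : ℕ) (hi : i < n) :
    (π ⟨2 * i, by omega⟩ : ℕ) / 2 = (π ⟨2 * i + 1, by omega⟩ : ℕ) / 2 := by
  induction i with
  | zero =>
    obtain ⟨q, hq, h⟩ := exists_neighbour hπ ⟨2 * 0, by omega⟩
    have : q = ⟨2 * 0 + 1, by omega⟩ := Fin.ext (by simp only at hq ⊢; omega)
    rw [h, this]
  | succ i ih =>
    obtain ⟨q, hq, h⟩ := exists_neighbour hπ ⟨2 * (i + 1), by omega⟩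
    simp only at hq
    rcases hq with hq | hq
    · have : q = ⟨2 * (i + 1) + 1, by omega⟩ := Fin.ext hq
      rw [h, this]
    · have : q = ⟨2 * i + 1, by omega⟩ := Fin.ext (by simp only; omega)
      rw [this] at h
      have ih' := ih (by omega)
      have h1 : (π ⟨2 * i, by omega⟩ : ℕ) ≠ π ⟨2 * i + 1, by omega⟩ := fun he => by
        simpa using π.injective (Fin.ext he)
      have h2 : (π ⟨2 * i, by omega⟩ : ℕ) ≠ π ⟨2 * (i + 1), by omega⟩ := fun he => by
        have := congrArg Fin.val (π.injective (Fin.ext he))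
        simp only at this
        omega
      have h3 : (π ⟨2 * i + 1, by omega⟩ : ℕ) ≠ π ⟨2 * (i + 1), by omega⟩ := fun he => by
        have := congrArg Fin.val (π.injective (Fin.ext he))
        simp only at this
        omega
      omega

/-- The permutation of `Fin (2n)` that sends the block of positions `2i`, `2i + 1` to the pair of
values `2σ(i)`, `2σ(i) + 1`, in decreasing order exactly if `2i + 1 ∈ S`. -/
noncomputable def blockPerm (S : Finset ℕ) (σ : Equiv.Perm (Fin n)) : Equiv.Perm (Fin (2 * n)) :=
  Equiv.ofBijective
    (fun p => ⟨2 * σ ⟨p / 2, by omega⟩ +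
      if (p : ℕ) % 2 = 0 ↔ 2 * (p / 2 : ℕ) + 1 ∈ S then 1 else 0, by split_ifs <;> omega⟩)
    (Finite.injective_iff_bijective.1 fun p q h => by
      simp only [Fin.mk.injEq] at h
      have hσ : σ ⟨p / 2, by omega⟩ = σ ⟨q / 2, by omega⟩ := by
        apply Fin.ext
        split_ifs at h <;> omega
      have hpq : (p : ℕ) / 2 = q / 2 := by simpa using σ.injective hσ
      rw [hσ, hpq] at h
      apply Fin.ext
      by_cases hS : 2 * ((q : ℕ) / 2) + 1 ∈ S <;> simp only [hS, iff_true, iff_false] at h <;>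
        split_ifs at h <;> omega)

theorem blockPerm_apply (S : Finset ℕ) (σ : Equiv.Perm (Fin n)) (p : Fin (2 * n)) :
    (blockPerm S σ p : ℕ) = 2 * σ ⟨p / 2, by omega⟩ +
      if (p : ℕ) % 2 = 0 ↔ 2 * (p / 2 : ℕ) + 1 ∈ S then 1 else 0 := rfl

theorem blockPerm_div_two (S : Finset ℕ) (σ : Equiv.Perm (Fin n)) (p : Fin (2 * n)) :
    (blockPerm S σ p : ℕ) / 2 = σ ⟨p / 2, by omega⟩ := by
  rw [blockPerm_apply]
  split_ifs <;> omega

theorem blockPerm_injective (S : Finset ℕ) :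
    Function.Injective (blockPerm S : Equiv.Perm (Fin n) → Equiv.Perm (Fin (2 * n))) := by
  intro σ τ h
  ext i
  have h' := blockPerm_div_two S τ ⟨2 * i, by omega⟩
  rw [← h, blockPerm_div_two] at h'
  simpa using h'

theorem pairAdjacent_blockPerm (S : Finset ℕ) (σ : Equiv.Perm (Fin n)) (k : Fin n) :
    PairAdjacent (blockPerm S σ) k := by
  have hb : ∀ p : Fin (2 * n), (p : ℕ) / 2 = σ.symm k → blockPerm S σ p = pairLo k ∨
      blockPerm S σ p = pairHi k := by
    intro p hp
    have h := blockPerm_div_two S σ p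
    have : (⟨p / 2, by omega⟩ : Fin n) = σ.symm k := Fin.ext hp
    rw [this, Equiv.apply_symm_apply] at h
    simp only [pairLo, pairHi, Fin.ext_iff]
    omega
  have hne : blockPerm S σ ⟨2 * σ.symm k, by omega⟩ ≠ blockPerm S σ ⟨2 * σ.symm k + 1, by omega⟩ :=
    fun h => by simpa using (blockPerm S σ).injective h
  unfold PairAdjacent
  rcases hb ⟨2 * σ.symm k, by omega⟩ (by simp) with h0 | h0 <;>
    rcases hb ⟨2 * σ.symm k + 1, by omega⟩ (by simp only; omega) with h1 | h1
  · exact absurd (h0.trans h1.symm) hne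
  · left
    rw [← h0, ← h1]
    simp
  · right
    rw [← h0, ← h1]
    simp
  · exact absurd (h0.trans h1.symm) hne

/-- The halves of the even elements of `S` that lie in `[n-1]`. -/
def evenHalves (n : ℕ) (S : Finset ℕ) : Finset ℕ := (Finset.Ico 1 n).filter fun i => 2 * i ∈ S

theorem even_mem_descentSet_iff {π : Equiv.Perm (Fin (2 * n))} {σ : Equiv.Perm (Fin n)}
    (h : ∀ p : Fin (2 * n), (π p : ℕ) / 2 = σ ⟨p / 2, by omega⟩) (i : ℕ) :
    2 * i ∈ descentSet (2 * n) π ↔ i ∈ descentSet n σ := by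
  simp only [mem_descentSet]
  constructor
  · rintro ⟨h1, h2, hlt⟩
    refine ⟨by omega, by omega, ?_⟩
    have ha := h ⟨2 * i, h2⟩
    have hb := h ⟨2 * i - 1, by omega⟩
    have ea : (⟨2 * i / 2, by omega⟩ : Fin n) = ⟨i, by omega⟩ := Fin.ext (by simp)
    have eb : (⟨(2 * i - 1) / 2, by omega⟩ : Fin n) = ⟨i - 1, by omega⟩ :=
      Fin.ext (by simp only; omega)
    simp only [ea, eb] at ha hb
    have hne : (σ ⟨i, by omega⟩ : ℕ) ≠ σ ⟨i - 1, by omega⟩ := fun he => by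
      have := congrArg Fin.val (σ.injective (Fin.ext he))
      simp only at this
      omega
    rw [Fin.lt_def] at hlt ⊢
    omega
  · rintro ⟨h1, h2, hlt⟩
    refine ⟨by omega, by omega, ?_⟩
    have ha := h ⟨2 * i, by omega⟩
    have hb := h ⟨2 * i - 1, by omega⟩
    have ea : (⟨2 * i / 2, by omega⟩ : Fin n) = ⟨i, by omega⟩ := Fin.ext (by simp)
    have eb : (⟨(2 * i - 1) / 2, by omega⟩ : Fin n) = ⟨i - 1, by omega⟩ :=
      Fin.ext (by simp only; omega)
    simp only [ea, eb] at ha hb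
    rw [Fin.lt_def] at hlt ⊢
    omega

theorem odd_mem_descentSet_blockPerm_iff (S : Finset ℕ) (σ : Equiv.Perm (Fin n)) {i : ℕ}
    (hi : i < n) : 2 * i + 1 ∈ descentSet (2 * n) (blockPerm S σ) ↔ 2 * i + 1 ∈ S := by
  have ea : (2 * i + 1) / 2 = i := by omega
  have eb : (2 * i + 1) % 2 = 1 := by omega
  simp only [mem_descentSet, Fin.lt_def, blockPerm_apply, ea, eb, Nat.add_sub_cancel,
    Nat.mul_div_cancel_left i two_pos, Nat.mul_mod_right]
  by_cases hS : 2 * i + 1 ∈ S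
  · simp [hS]
    omega
  · simp [hS]

theorem descentSet_blockPerm {S : Finset ℕ} (hS : S ⊆ Finset.Ico 1 (2 * n))
    {σ : Equiv.Perm (Fin n)} :
    descentSet (2 * n) (blockPerm S σ) = S ↔ descentSet n σ = evenHalves n S := by
  have heven := even_mem_descentSet_iff (blockPerm_div_two S σ)
  constructor
  · intro h
    ext i
    rw [← heven, h, evenHalves, Finset.mem_filter]
    refine ⟨fun hi => ⟨?_, hi⟩, fun hi => hi.2⟩
    have := Finset.mem_Ico.1 (hS hi)
    rw [Finset.mem_Ico]
    omega
  · intro h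
    ext i
    obtain ⟨m, rfl | rfl⟩ := Nat.even_or_odd' i
    · rw [heven, h, evenHalves, Finset.mem_filter]
      refine ⟨fun hi => hi.2, fun hi => ⟨?_, hi⟩⟩
      have := Finset.mem_Ico.1 (hS hi)
      rw [Finset.mem_Ico]
      omega
    · by_cases hm : m < n
      · exact odd_mem_descentSet_blockPerm_iff S σ hm
      · refine iff_of_false (fun hi => ?_) fun hi => ?_
        · obtain ⟨_, h2, _⟩ := mem_descentSet.1 hi
          omega
        · have := Finset.mem_Ico.1 (hS hi)
          omega

theorem exists_blockPerm_eq {π : Equiv.Perm (Fin (2 * n))} (hπ : ∀ k, PairAdjacent π k) :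
    ∃ σ, blockPerm (descentSet (2 * n) π) σ = π := by
  have hblock := PairAdjacent.apply_div_two_eq hπ
  have hpos : ∀ p : Fin (2 * n), (π p : ℕ) / 2 = (π ⟨2 * (p / 2 : ℕ), by omega⟩ : ℕ) / 2 := by
    rintro ⟨p, hp⟩
    obtain ⟨m, hm⟩ := Nat.even_or_odd' p
    have hm2 : p / 2 = m := by omega
    simp only [hm2]
    rcases hm with rfl | rfl
    · rfl
    · exact (hblock m (by omega)).symm
  let f : Fin n → Fin n := fun i => ⟨(π ⟨2 * i, by omega⟩ : ℕ) / 2, by omega⟩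
  have hf : Function.Surjective f := by
    intro k
    refine ⟨⟨(π.symm (pairLo k) : ℕ) / 2, by omega⟩, Fin.ext ?_⟩
    simp only [f]
    rw [← hpos, Equiv.apply_symm_apply]
    simp [pairLo]
  let σ : Equiv.Perm (Fin n) := Equiv.ofBijective f (Finite.surjective_iff_bijective.1 hf)
  have hσ : ∀ i : Fin n, (σ i : ℕ) = (π ⟨2 * i, by omega⟩ : ℕ) / 2 := fun i => rfl
  refine ⟨σ, Equiv.ext fun p => Fin.ext ?_⟩
  rw [blockPerm_apply, hσ]
  simp only
  rw [← hpos]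
  obtain ⟨p, hp⟩ := p
  obtain ⟨m, hm⟩ := Nat.even_or_odd' p
  have hm2 : p / 2 = m := by omega
  have hb := hblock m (by omega)
  have hne : (π ⟨2 * m, by omega⟩ : ℕ) ≠ π ⟨2 * m + 1, by omega⟩ := fun he => by
    simpa using π.injective (Fin.ext he)
  have hmem : 2 * m + 1 ∈ descentSet (2 * n) π ↔
      (π ⟨2 * m + 1, by omega⟩ : ℕ) < π ⟨2 * m, by omega⟩ := by
    rw [mem_descentSet]
    exact ⟨fun ⟨_, _, h⟩ => h, fun h => ⟨by omega, by omega, h⟩⟩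
  simp only [hm2, hmem]
  rcases hm with rfl | rfl
  · simp only [Nat.mul_mod_right, true_iff]
    split_ifs <;> omega
  · simp only [show ¬ ((2 * m + 1) % 2 = 0) by omega, false_iff]
    split_ifs <;> omega

/-- Modulo `2`, the statistic `β_{2n}(S)` only depends on the even elements of `S`. -/
theorem even_beta_two_mul_iff {S : Finset ℕ} (hS : S ⊆ Finset.Ico 1 (2 * n)) :
    Even (beta (2 * n) S) ↔ Even (beta n (evenHalves n S)) := by
  have hsplit : beta (2 * n) S =
      (Finset.univ.filter fun π : Equiv.Perm (Fin (2 * n)) =>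
        descentSet (2 * n) π = S ∧ (separatedPairs π).Nonempty).card +
      (Finset.univ.filter fun π : Equiv.Perm (Fin (2 * n)) =>
        descentSet (2 * n) π = S ∧ ¬ (separatedPairs π).Nonempty).card := by
    rw [beta, ← Finset.card_filter_add_card_filter_not (fun π => (separatedPairs π).Nonempty),
      Finset.filter_filter, Finset.filter_filter]
  have hcard : beta n (evenHalves n S) =
      (Finset.univ.filter fun π : Equiv.Perm (Fin (2 * n)) =>
        descentSet (2 * n) π = S ∧ ¬ (separatedPairs π).Nonempty).card := by
    refine Finset.card_nbij (blockPerm S) ?_ (blockPerm_injective S).injOn ?_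
    · intro σ hσ
      simp only [Finset.coe_filter, Finset.mem_univ, true_and, Set.mem_ofPred_eq] at hσ ⊢
      refine ⟨(descentSet_blockPerm hS).2 hσ, ?_⟩
      simp [separatedPairs, pairAdjacent_blockPerm]
    · intro π hπ
      simp only [Finset.coe_filter, Finset.mem_univ, true_and, Set.mem_ofPred_eq] at hπ
      obtain ⟨rfl, hπ⟩ := hπ
      have hadj : ∀ k, PairAdjacent π k := by
        simpa [separatedPairs, Finset.not_nonempty_iff_eq_empty, Finset.filter_eq_empty_iff]
          using hπ
      obtain ⟨σ, hσ⟩ := exists_blockPerm_eq hadj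
      refine ⟨σ, ?_, hσ⟩
      simp only [Finset.coe_filter, Finset.mem_univ, true_and, Set.mem_ofPred_eq]
      exact (descentSet_blockPerm hS).1 (by rw [hσ])
  rw [hsplit, ← hcard, Nat.even_add, iff_true_left (even_card_separated S)]

end BetaParity

section Expansions

/-- The letters of a word in the positions `1, 3, 5, …` (counting from `1`). -/
def oddLetters : List Bool → List Bool
  | [] => []
  | [x] => [x]
  | x :: _ :: l => x :: oddLetters l

/-- The letters of a word in the positions `2, 4, 6, …` (counting from `1`). -/
def evenLetters (l : List Bool) : List Bool := oddLetters l.tail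

theorem oddLetters_cons (x : Bool) (l : List Bool) :
    oddLetters (x :: l) = x :: evenLetters l := by
  cases l <;> rfl

theorem evenLetters_cons (x : Bool) (l : List Bool) : evenLetters (x :: l) = oddLetters l := rfl

theorem getD_oddLetters (l : List Bool) (i : ℕ) :
    (oddLetters l).getD i false = l.getD (2 * i) false := by
  induction l using oddLetters.induct generalizing i with
  | case1 => simp [oddLetters]
  | case2 x => cases i <;> simp [oddLetters, Nat.mul_add]
  | case3 x y l ih =>
    cases i with
    | zero => simp [oddLetters]
    | succ i => simpa [oddLetters, Nat.mul_add] using ih i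

theorem getD_evenLetters (l : List Bool) (i : ℕ) :
    (evenLetters l).getD i false = l.getD (2 * i + 1) false := by
  cases l with
  | nil => simp [evenLetters, oddLetters]
  | cons x l => rw [evenLetters_cons, getD_oddLetters, List.getD_cons_succ]

theorem nodup_expansions (w : List Bool) : (expansions w).Nodup := by
  induction w with
  | nil => simp [expansions]
  | cons x w ih =>
    cases x <;>
    · rw [expansions, List.nodup_flatMap]
      refine ⟨by simp, ih.imp fun {u v} huv => ?_⟩
      simp [Function.onFun, List.disjoint_left, huv]

/-- The sum of `h` over the expansion of the `cd`-word `w`. -/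
def expansionSum (w : List Bool) (h : List Bool → ℚ) : ℚ := ((expansions w).map h).sum

theorem sum_map_flatMap_pair (L : List (List Bool)) (f g : List Bool → List Bool)
    (h : List Bool → ℚ) :
    ((L.flatMap fun u => [f u, g u]).map h).sum = (L.map fun u => h (f u) + h (g u)).sum := by
  induction L with
  | nil => simp
  | cons u L ih =>
    simp only [List.flatMap_cons, List.map_append, List.sum_append, ih]
    simp

theorem expansionSum_c (w : List Bool) (h : List Bool → ℚ) :
    expansionSum (false :: w) h = expansionSum w fun u => h (false :: u) + h (true :: u) :=
  sum_map_flatMap_pair _ _ _ h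

theorem expansionSum_d (w : List Bool) (h : List Bool → ℚ) :
    expansionSum (true :: w) h =
      expansionSum w fun u => h (false :: true :: u) + h (true :: false :: u) :=
  sum_map_flatMap_pair _ _ _ h

theorem expansionSum_add_self (w : List Bool) (h : List Bool → ℚ) :
    (expansionSum w fun u => h u + h u) = 2 * expansionSum w h := by
  rw [expansionSum, List.sum_map_add, two_mul, expansionSum]

/-- The degree of a `cd`-word. -/
def cdDegree (w : List Bool) : ℕ := (w.map fun x => if x then 2 else 1).sum

theorem length_add_count_true (w : List Bool) : w.length + w.count true = cdDegree w := by
  induction w with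
  | nil => rfl
  | cons x w ih => cases x <;> simp [cdDegree] at ih ⊢ <;> omega

theorem two_mul_count_true_le (w : List Bool) : 2 * w.count true ≤ cdDegree w := by
  have h1 := length_add_count_true w
  have h2 := List.count_le_length (a := true) (l := w)
  omega

/-- In the expansion of a `cd`-word of degree `m`, all words in the `m / 2` even positions occur
equally often, and so do all words in the `(m + 1) / 2` odd positions. -/
theorem expansionSum_letters (w : List Bool) :
    (∀ h : List Bool → ℚ, 2 ^ (cdDegree w / 2) * expansionSum w (fun u => h (evenLetters u)) =
      2 ^ w.length * expansionSum (List.replicate (cdDegree w / 2) false) h) ∧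
    (∀ h : List Bool → ℚ, 2 ^ ((cdDegree w + 1) / 2) * expansionSum w (fun u => h (oddLetters u)) =
      2 ^ w.length * expansionSum (List.replicate ((cdDegree w + 1) / 2) false) h) := by
  induction w with
  | nil => simp [cdDegree, expansionSum, expansions, evenLetters, oddLetters]
  | cons x w ih =>
    obtain ⟨ihe, iho⟩ := ih
    cases x with
    | false =>
      have hd : cdDegree (false :: w) = cdDegree w + 1 := by simp [cdDegree, add_comm]
      have hd2 : (cdDegree w + 1 + 1) / 2 = cdDegree w / 2 + 1 := by omega
      rw [hd, hd2, List.length_cons]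
      refine ⟨fun h => ?_, fun h => ?_⟩
      · simp only [expansionSum_c, evenLetters_cons]
        rw [expansionSum_add_self]
        linear_combination 2 * iho h
      · simp only [expansionSum_c, oddLetters_cons, List.replicate_succ]
        linear_combination 2 * ihe fun u => h (false :: u) + h (true :: u)
    | true =>
      have hd : cdDegree (true :: w) = cdDegree w + 2 := by simp [cdDegree, add_comm]
      have hd2 : (cdDegree w + 2) / 2 = cdDegree w / 2 + 1 := by omega
      have hd3 : (cdDegree w + 2 + 1) / 2 = (cdDegree w + 1) / 2 + 1 := by omega
      rw [hd, hd2, hd3, List.length_cons]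
      refine ⟨fun h => ?_, fun h => ?_⟩
      · simp only [expansionSum_d, expansionSum_c, evenLetters_cons, oddLetters_cons,
          List.replicate_succ]
        simp only [add_comm (h (true :: evenLetters _))]
        linear_combination 2 * ihe fun u => h (false :: u) + h (true :: u)
      · simp only [expansionSum_d, expansionSum_c, evenLetters_cons, oddLetters_cons,
          List.replicate_succ]
        linear_combination 2 * iho fun u => h (false :: u) + h (true :: u)

theorem filter_getD_cons (x : Bool) (l : List Bool) (a k : ℕ) :
    ((Finset.Ico a (a + (k + 1))).filter fun i => (x :: l).getD (i - a) false = true) =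
      if x then insert a
        ((Finset.Ico (a + 1) (a + 1 + k)).filter fun i => l.getD (i - (a + 1)) false = true)
      else (Finset.Ico (a + 1) (a + 1 + k)).filter fun i => l.getD (i - (a + 1)) false = true := by
  ext i
  rcases lt_trichotomy i a with h | rfl | h
  · cases x <;> simp <;> omega
  · cases x <;> simp
  · obtain ⟨t, rfl⟩ := Nat.exists_eq_add_of_lt h
    have h1 : a + t + 1 - a = t + 1 := by omega
    have h2 : a + t + 1 - (a + 1) = t := by omega
    have h3 : a + t + 1 ∈ Finset.Ico a (a + (k + 1)) ↔
        a + t + 1 ∈ Finset.Ico (a + 1) (a + 1 + k) := by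
      simp only [Finset.mem_Ico]
      omega
    have h4 : a + t + 1 ≠ a := by omega
    cases x <;> simp only [Bool.false_eq_true, if_true, if_false, Finset.mem_insert,
      Finset.mem_filter, h1, h2, h3, h4, List.getD_cons_succ, false_or]

theorem expansionSum_replicate_c (k a : ℕ) (g : Finset ℕ → ℚ) :
    expansionSum (List.replicate k false)
      (fun l => g ((Finset.Ico a (a + k)).filter fun i => l.getD (i - a) false = true)) =
      ∑ T ∈ (Finset.Ico a (a + k)).powerset, g T := by
  induction k generalizing a g with
  | zero => simp [expansionSum, expansions]
  | succ k ih =>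
    have hins : Finset.Ico a (a + (k + 1)) = insert a (Finset.Ico (a + 1) (a + 1 + k)) := by
      ext i
      simp only [Finset.mem_Ico, Finset.mem_insert]
      omega
    rw [List.replicate_succ, expansionSum_c]
    simp only [filter_getD_cons]
    rw [hins, Finset.sum_powerset_insert (by simp), ← Finset.sum_add_distrib,
      ← ih (a + 1) fun T => g T + g (insert a T)]
    simp

end Expansions

theorem sum_neg_one_pow_beta {n : ℕ} :
    ∑ T ∈ (Finset.Ico 1 n).powerset, (-1 : ℚ) ^ beta n T = 2 ^ (n - 1) * (1 - 2 * rho n) := by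
  have h : ∀ T, (-1 : ℚ) ^ beta n T = 1 - 2 * if Odd (beta n T) then 1 else 0 := by
    intro T
    split_ifs with hT
    · rw [hT.neg_one_pow]
      norm_num
    · rw [(Nat.not_odd_iff_even.1 hT).neg_one_pow]
      norm_num
  simp only [h, Finset.sum_sub_distrib, ← Finset.mul_sum, Finset.sum_boole, rho]
  simp only [Finset.sum_const, Finset.card_powerset, Nat.card_Ico, nsmul_eq_mul, mul_one]
  push_cast
  field_simp

/-- For a `cd`-monomial `w` of degree `2n - 1` (where `c` has degree 1 and `d`
degree 2) with exactly `j` letters `d`, summing `(-1)^{β_{2n}(S_u)}` over all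
`ab`-monomials `u` in the expansion of `w` gives `2^{2n-j-1}·(1 - 2ρ(n))`;
here `S_u = {i ∈ [2n-1] : u_i = b}`. -/
theorem sum_expansion_eq (n : ℕ) (hn : 1 ≤ n) (w : List Bool) (j : ℕ)
    (hdeg : (w.map fun x => if x then 2 else 1).sum = 2 * n - 1)
    (hj : w.count true = j) :
    ∑ u ∈ (expansions w).toFinset,
        (-1 : ℚ) ^ beta (2 * n)
          ((Finset.Ico 1 (2 * n)).filter fun i => u.getD (i - 1) false = true)
      = 2 ^ (2 * n - j - 1) * (1 - 2 * rho n) := by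
  have hterm : ∀ u : List Bool, (-1 : ℚ) ^ beta (2 * n)
      ((Finset.Ico 1 (2 * n)).filter fun i => u.getD (i - 1) false = true) =
      (-1 : ℚ) ^ beta n
        ((Finset.Ico 1 (1 + (n - 1))).filter fun i => (evenLetters u).getD (i - 1) false = true) := by
    intro u
    have hset : evenHalves n ((Finset.Ico 1 (2 * n)).filter fun i => u.getD (i - 1) false = true) =
        (Finset.Ico 1 (1 + (n - 1))).filter fun i => (evenLetters u).getD (i - 1) false = true := by
      ext i
      simp only [evenHalves, Finset.mem_filter, Finset.mem_Ico, getD_evenLetters]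
      constructor
      · rintro ⟨h1, -, h2⟩
        rw [show 2 * i - 1 = 2 * (i - 1) + 1 by omega] at h2
        exact ⟨by omega, h2⟩
      · rintro ⟨h1, h2⟩
        rw [show 2 * (i - 1) + 1 = 2 * i - 1 by omega] at h2
        exact ⟨by omega, by omega, h2⟩
    have heven := even_beta_two_mul_iff (Finset.filter_subset
      (fun i => u.getD (i - 1) false = true) (Finset.Ico 1 (2 * n)))
    rw [hset] at heven
    rcases Nat.even_or_odd (beta (2 * n)
      ((Finset.Ico 1 (2 * n)).filter fun i => u.getD (i - 1) false = true)) with h | h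
    · rw [h.neg_one_pow, (heven.1 h).neg_one_pow]
    · rw [h.neg_one_pow, Odd.neg_one_pow]
      rwa [← Nat.not_even_iff_odd, ← heven, Nat.not_even_iff_odd]
  have hdeg' : cdDegree w = 2 * n - 1 := hdeg
  have hlen := length_add_count_true w
  have hle := two_mul_count_true_le w
  have hsum := (expansionSum_letters w).1 fun l => (-1 : ℚ) ^ beta n
    ((Finset.Ico 1 (1 + (n - 1))).filter fun i => l.getD (i - 1) false = true)
  rw [expansionSum, show cdDegree w / 2 = n - 1 by omega,
    expansionSum_replicate_c (n - 1) 1 fun T => (-1 : ℚ) ^ beta n T,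
    show 1 + (n - 1) = n by omega, sum_neg_one_pow_beta,
    show w.length = 2 * n - j - 1 by omega] at hsum
  simp only [hterm]
  rw [List.sum_toFinset _ (nodup_expansions w), show 1 + (n - 1) = n by omega]
  refine mul_left_cancel₀ (pow_ne_zero (n - 1) (two_ne_zero (α := ℚ))) (hsum.trans ?_)
  ring
end
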